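/- The function f(x) = (x−1)/log x (extended by f(1) = 1) is operator monotone on (0,∞), symmetric (f(x) = x f(1/x)) and normalized (f(1) = 1). -/

import Mathlib

open Real ComplexOrder

/-- The BKM function `f(x) = (x−1)/log x`, extended by `f(1) = 1`. -/
noncomputable def fBKM (x : ℝ) : ℝ := if x = 1 then 1 else (x - 1) / Real.log x

open scoped Matrix

/-- The quadratic form of `f(A)` is a weighted sum of the values of `f` on the eigenvalues. -/
lemma Matrix.IsHermitian.star_dotProduct_cfc_mulVec {n : Type*} [Fintype n] [DecidableEq n]
    {A : Matrix n n ℂ} (hA : A.IsHermitian) (f : ℝ → ℝ) (v : n → ℂ) :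
    star v ⬝ᵥ (hA.cfc f *ᵥ v) =
      ((∑ i, f (hA.eigenvalues i) *
        Complex.normSq ((star (hA.eigenvectorUnitary : Matrix n n ℂ) *ᵥ v) i) : ℝ) : ℂ) := by
  have h : star v ᵥ* (hA.eigenvectorUnitary : Matrix n n ℂ) =
      star (star (hA.eigenvectorUnitary : Matrix n n ℂ) *ᵥ v) := by
    rw [Matrix.star_mulVec, Matrix.star_eq_conjTranspose, Matrix.conjTranspose_conjTranspose]
  rw [Matrix.IsHermitian.cfc, Unitary.conjStarAlgAut_apply, ← Matrix.mulVec_mulVec,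
    ← Matrix.mulVec_mulVec, Matrix.dotProduct_mulVec, h]
  simp only [dotProduct, Matrix.mulVec_diagonal, Complex.ofReal_sum, Complex.ofReal_mul,
    Complex.normSq_eq_conj_mul_self, Pi.star_apply, Function.comp_apply, RCLike.star_def,
    Complex.coe_algebraMap]
  exact Finset.sum_congr rfl fun i _ => by ring

lemma Matrix.IsHermitian.isHermitian_cfc {n : Type*} [Fintype n] [DecidableEq n]
    {A : Matrix n n ℂ} (hA : A.IsHermitian) (f : ℝ → ℝ) : (hA.cfc f).IsHermitian := by
  rw [← hA.cfc_eq f]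
  exact cfc_predicate f A

open scoped MatrixOrder Matrix.Norms.L2Operator in
/-- The Löwner–Heinz inequality for positive semidefinite matrices. -/
lemma Matrix.PosSemidef.cfc_rpow_sub {n : Type*} [Fintype n] [DecidableEq n]
    {A B : Matrix n n ℂ} (hA : A.PosSemidef) (hB : B.PosSemidef) (hAB : (B - A).PosSemidef)
    {s : ℝ} (hs : s ∈ Set.Icc (0 : ℝ) 1) :
    (hB.1.cfc (fun x => x ^ s) - hA.1.cfc (fun x => x ^ s)).PosSemidef := by
  have h : A ^ s ≤ B ^ s := CFC.rpow_le_rpow hs hAB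
  rw [CFC.rpow_eq_cfc_real hA.nonneg, CFC.rpow_eq_cfc_real hB.nonneg,
    hA.1.cfc_eq, hB.1.cfc_eq] at h
  exact h

/-- Integrating a family of functions that is monotone on the pair `A ≤ B` gives a function that is
monotone on this pair. -/
lemma Matrix.PosSemidef.cfc_sub_of_eq_integral {n : Type*} [Fintype n] [DecidableEq n]
    {A B : Matrix n n ℂ} (hA : A.PosSemidef) (hB : B.PosSemidef) {f : ℝ → ℝ} {g : ℝ → ℝ → ℝ}
    (hg : ∀ x, 0 ≤ x → IntervalIntegrable (g x) MeasureTheory.volume 0 1)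
    (hf : ∀ x, 0 ≤ x → f x = ∫ s in (0 : ℝ)..1, g x s)
    (h : ∀ s ∈ Set.Icc (0 : ℝ) 1,
      (hB.1.cfc (fun x => g x s) - hA.1.cfc (fun x => g x s)).PosSemidef) :
    (hB.1.cfc f - hA.1.cfc f).PosSemidef := by
  refine .of_dotProduct_mulVec_nonneg ((hB.1.isHermitian_cfc f).sub (hA.1.isHermitian_cfc f))
    fun v => ?_
  have key {C : Matrix n n ℂ} (hC : C.PosSemidef) (c : n → ℝ) :
      IntervalIntegrable (fun s => ∑ i, g (hC.1.eigenvalues i) s * c i)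
        MeasureTheory.volume 0 1 ∧
      ∑ i, f (hC.1.eigenvalues i) * c i =
        ∫ s in (0 : ℝ)..1, ∑ i, g (hC.1.eigenvalues i) s * c i := by
    have hi i : IntervalIntegrable (fun s => g (hC.1.eigenvalues i) s * c i)
        MeasureTheory.volume 0 1 := (hg _ (hC.eigenvalues_nonneg i)).mul_const _
    refine ⟨by simpa only [Finset.sum_fn] using
      IntervalIntegrable.sum Finset.univ fun i _ => hi i, ?_⟩
    rw [intervalIntegral.integral_finsetSum fun i _ => hi i]
    simp_rw [intervalIntegral.integral_mul_const]
    exact Finset.sum_congr rfl fun i _ => by rw [hf _ (hC.eigenvalues_nonneg i)]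
  rw [Matrix.sub_mulVec, dotProduct_sub, sub_nonneg, hA.1.star_dotProduct_cfc_mulVec,
    hB.1.star_dotProduct_cfc_mulVec, Complex.real_le_real, (key hA _).2, (key hB _).2]
  refine intervalIntegral.integral_mono_on zero_le_one (key hA _).1 (key hB _).1 fun s hs => ?_
  have h' := (h s hs).dotProduct_mulVec_nonneg v
  rwa [Matrix.sub_mulVec, dotProduct_sub, sub_nonneg, hA.1.star_dotProduct_cfc_mulVec,
    hB.1.star_dotProduct_cfc_mulVec, Complex.real_le_real] at h'

lemma zero_rpow_eqOn_uIoc : Set.EqOn (fun s : ℝ => (0 : ℝ) ^ s) 0 (Set.uIoc 0 1) := fun s hs => by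
  rw [Set.uIoc_of_le zero_le_one] at hs
  exact Real.zero_rpow hs.1.ne'

lemma intervalIntegrable_const_rpow {x : ℝ} (hx : 0 ≤ x) :
    IntervalIntegrable (fun s : ℝ => x ^ s) MeasureTheory.volume 0 1 := by
  obtain rfl | hx := hx.eq_or_lt
  · exact (intervalIntegrable_const (c := (0 : ℝ))).congr fun s hs => (zero_rpow_eqOn_uIoc hs).symm
  · exact (Real.continuous_const_rpow hx.ne').intervalIntegrable _ _

lemma fBKM_eq_integral {x : ℝ} (hx : 0 ≤ x) : fBKM x = ∫ s in (0 : ℝ)..1, x ^ s := by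
  obtain rfl | hx := hx.eq_or_lt
  · rw [intervalIntegral.integral_congr_ae (.of_forall zero_rpow_eqOn_uIoc)]
    simp [fBKM]
  by_cases h1 : x = 1
  · simp [fBKM, h1]
  have hl : Real.log x ≠ 0 := Real.log_ne_zero_of_pos_of_ne_one hx h1
  simp_rw [Real.rpow_def_of_pos hx]
  rw [intervalIntegral.integral_comp_mul_left (fun t => Real.exp t) hl, integral_exp]
  simp [fBKM, h1, Real.exp_log hx]
  field_simp

/-- `fBKM` is operator monotone, symmetric and normalized. -/
theorem fBKM_operatorMonotone_symmetric_normalized :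
    (∀ (m : ℕ) (A B : Matrix (Fin m) (Fin m) ℂ) (hA : A.PosSemidef)
        (hB : B.PosSemidef), (B - A).PosSemidef →
        (hB.1.cfc fBKM - hA.1.cfc fBKM).PosSemidef) ∧
    fBKM 1 = 1 ∧ ∀ x : ℝ, 0 < x → fBKM x = x * fBKM (1 / x) := by
  refine ⟨fun m A B hA hB hAB => ?_, if_pos rfl, fun x hx => ?_⟩
  · exact hA.cfc_sub_of_eq_integral hB (fun x => intervalIntegrable_const_rpow)
      (fun x => fBKM_eq_integral) fun s hs => hA.cfc_rpow_sub hB hAB hs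
  · by_cases h1 : x = 1
    · simp [fBKM, h1]
    have hl : Real.log x ≠ 0 := Real.log_ne_zero_of_pos_of_ne_one hx h1
    simp only [fBKM, h1, one_div, inv_eq_one, if_false, Real.log_inv]
    field_simp
    ring
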